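/- arXiv:2408.03067 — 2 statements merged into one kernel-verified Lean document; each statement's English description precedes it below -/
import Mathlib

section
/- Let n ≥ 2, γ > −n, and q > 2. Assume f : ℝⁿ → [0,∞) is measurable and satisfies: the mass bound m₀ ≤ ∫_{ℝⁿ} f(v) dv ≤ M₀; the pressure lower bound inf_{σ ∈ S^{n-1}} sup_{e ∈ S^{n-1}, e ⊥ σ} ∫_{ℝⁿ} f(v̄ + w) |w·e|² dw ≥ p₀ > 0, where v̄ := (∫_{ℝⁿ} f(v) v dv)/(∫_{ℝⁿ} f(v) dv); and the moment bound ∫_{ℝⁿ} f(v) |v|^q dv ≤ M_q. Then there exists λ > 0, depending only on n, m₀, M₀, p₀, M_q, q, γ, such that for every v ∈ ℝⁿ and every e ∈ S^{n-1}: ∫_{ℝⁿ} (1 − (w·e)²/|w|²) |w|^{γ+2} f(v − w) dw ≥ λ (1 + |v|)^γ. (Equivalently, e·A(v)e ≥ λ(1+|v|)^γ, where A(v) is the Landau diffusion matrix associated to f.) -/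
open MeasureTheory Metric Set
open scoped ENNReal RealInnerProductSpace NNReal

noncomputable section

/-- `ℝⁿ` -/
abbrev En (n : ℕ) := EuclideanSpace ℝ (Fin n)

/-- The mean velocity `v̄ = (∫ f v dv) / (∫ f dv)`. -/
def vbar {n : ℕ} (f : En n → ℝ) : En n := (∫ v, f v)⁻¹ • ∫ v, f v • v

/-- Mass bounds `m₀ ≤ ∫ f ≤ M₀`. -/
def MassBound {n : ℕ} (f : En n → ℝ) (m₀ M₀ : ℝ) : Prop :=
  ENNReal.ofReal m₀ ≤ (∫⁻ v, ENNReal.ofReal (f v)) ∧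
    (∫⁻ v, ENNReal.ofReal (f v)) ≤ ENNReal.ofReal M₀

/-- Pressure lower bound:
`inf_{σ ∈ S^{n-1}} sup_{e ∈ S^{n-1}, e ⊥ σ} ∫ f(v̄+w) |w·e|² dw ≥ p₀`,
written via the ε-characterization of the supremum. -/
def PressureLB {n : ℕ} (f : En n → ℝ) (p₀ : ℝ) : Prop :=
  ∀ σ : En n, ‖σ‖ = 1 → ∀ ε : ℝ, 0 < ε → ∃ e : En n, ‖e‖ = 1 ∧ ⟪e, σ⟫ = 0 ∧
    ENNReal.ofReal (p₀ - ε) ≤ ∫⁻ w, ENNReal.ofReal (f (vbar f + w) * ⟪w, e⟫ ^ 2)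

/-- Moment bound `∫ f(v) |v|^q dv ≤ M_q`. -/
def MomentBound {n : ℕ} (f : En n → ℝ) (q Mq : ℝ) : Prop :=
  (∫⁻ v, ENNReal.ofReal (f v * ‖v‖ ^ q)) ≤ ENNReal.ofReal Mq

/-- The component of `y` orthogonal to `e`, when `e` is a unit vector. -/
def perpPart {E : Type*} [NormedAddCommGroup E] [InnerProductSpace ℝ E] (e y : E) : E :=
  y - ⟪y, e⟫ • e

section PerpPart

variable {E : Type*} [NormedAddCommGroup E] [InnerProductSpace ℝ E]

lemma perpPart_sub (e x y : E) : perpPart e (x - y) = perpPart e x - perpPart e y := by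
  simp only [perpPart, inner_sub_left, sub_smul]
  abel

lemma norm_sq_perpPart {e : E} (he : ‖e‖ = 1) (y : E) :
    ‖perpPart e y‖ ^ 2 = ‖y‖ ^ 2 - ⟪y, e⟫ ^ 2 := by
  rw [perpPart, norm_sub_sq_real, inner_smul_right, norm_smul, he, Real.norm_eq_abs, mul_one,
    sq_abs]
  ring

lemma norm_perpPart_le {e : E} (he : ‖e‖ = 1) (y : E) : ‖perpPart e y‖ ≤ ‖y‖ := by
  refine le_of_sq_le_sq ?_ (norm_nonneg _)
  rw [norm_sq_perpPart he]
  nlinarith [sq_nonneg ⟪y, e⟫]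

lemma inner_sq_le_norm_sq_perpPart {e e' : E} (he' : ‖e'‖ = 1) (h : ⟪e', e⟫ = 0) (y : E) :
    ⟪y, e'⟫ ^ 2 ≤ ‖perpPart e y‖ ^ 2 := by
  have h1 : ⟪y, e'⟫ = ⟪perpPart e y, e'⟫ := by
    rw [perpPart, inner_sub_left, real_inner_smul_left, real_inner_comm e' e, h]
    ring
  rw [h1]
  refine sq_le_sq.2 ?_
  simpa [he'] using abs_real_inner_le_norm (perpPart e y) e'

lemma norm_sq_perpPart_sub_le {e : E} (he : ‖e‖ = 1) (x v : E) :
    ‖perpPart e (x - v)‖ ^ 2 ≤ 2 * ‖x‖ ^ 2 + 2 * ‖perpPart e v‖ ^ 2 := by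
  rw [perpPart_sub]
  have h1 := norm_sub_le (perpPart e x) (perpPart e v)
  have h2 := norm_perpPart_le he x
  nlinarith [norm_nonneg (perpPart e x - perpPart e v), norm_nonneg (perpPart e x),
    norm_nonneg (perpPart e v), sq_nonneg (‖x‖ - ‖perpPart e v‖)]

lemma sub_le_norm_perpPart_sub {e : E} (he : ‖e‖ = 1) (x v : E) :
    ‖perpPart e v‖ - ‖x‖ ≤ ‖perpPart e (x - v)‖ := by
  rw [perpPart_sub, norm_sub_rev]
  linarith [norm_sub_norm_le (perpPart e v) (perpPart e x), norm_perpPart_le he x]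

lemma continuous_perpPart (e : E) : Continuous (perpPart e) := by
  unfold perpPart
  fun_prop

/-- If `x` stays in a ball and away from the line `v + ℝ e`, then `‖x - v‖` is comparable
to `1 + ‖v‖`. -/
lemma min_rpow_mul_le_norm_sub_rpow {e x v : E} (he : ‖e‖ = 1) {R δ : ℝ} (γ : ℝ)
    (hR : 1 ≤ R) (hδ : 0 < δ) (hδ1 : δ ≤ 1) (hx : ‖x‖ ≤ R)
    (hxd : δ ≤ ‖perpPart e (x - v)‖ ^ 2) :
    min ((δ / (4 + 8 * R)) ^ γ) (R ^ γ) * (1 + ‖v‖) ^ γ ≤ ‖x - v‖ ^ γ := by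
  have hv := norm_nonneg v
  have hpos : 0 < 1 + ‖v‖ := by positivity
  have hc : 0 < δ / (4 + 8 * R) := by positivity
  have hlow : δ ≤ ‖x - v‖ := by
    have h1 := norm_perpPart_le he (x - v)
    nlinarith [norm_nonneg (perpPart e (x - v)), norm_nonneg (x - v)]
  have hlower : δ / (4 + 8 * R) * (1 + ‖v‖) ≤ ‖x - v‖ := by
    rw [div_mul_eq_mul_div, div_le_iff₀ (by positivity)]
    rcases le_total ‖v‖ (2 * R) with h | h
    · nlinarith [mul_le_mul_of_nonneg_left h hδ.le,
        mul_le_mul_of_nonneg_right hlow (by positivity : 0 ≤ 4 + 8 * R)]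
    · have h1 : ‖v‖ - ‖x‖ ≤ ‖x - v‖ := norm_sub_rev x v ▸ norm_sub_norm_le v x
      have h2 : 1 + ‖v‖ ≤ 4 * ‖x - v‖ := by linarith
      nlinarith [mul_le_mul_of_nonneg_right hδ1 hpos.le, norm_nonneg (x - v)]
  have hupper : ‖x - v‖ ≤ R * (1 + ‖v‖) := by
    nlinarith [norm_sub_le x v]
  rcases le_total 0 γ with h | h
  · calc _ ≤ (δ / (4 + 8 * R)) ^ γ * (1 + ‖v‖) ^ γ := by gcongr; exact min_le_left _ _
      _ = (δ / (4 + 8 * R) * (1 + ‖v‖)) ^ γ := (Real.mul_rpow hc.le hpos.le).symm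
      _ ≤ _ := Real.rpow_le_rpow (by positivity) hlower h
  · calc _ ≤ R ^ γ * (1 + ‖v‖) ^ γ := by gcongr; exact min_le_right _ _
      _ = (R * (1 + ‖v‖)) ^ γ := (Real.mul_rpow (by linarith) hpos.le).symm
      _ ≤ _ := Real.rpow_le_rpow_of_nonpos (hδ.trans_le hlow) hupper h

end PerpPart

section Moments

variable {E : Type*} [NormedAddCommGroup E] [MeasurableSpace E] [BorelSpace E] {μ : Measure E}
  [IsFiniteMeasure μ]

lemma integrable_norm_sq_of_integrable_norm_rpow {q : ℝ} (hq : 2 < q)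
    (h : Integrable (fun x : E => ‖x‖ ^ q) μ) : Integrable (fun x : E => ‖x‖ ^ 2) μ := by
  refine ((integrable_const 1).add h).mono' (by fun_prop) (ae_of_all _ fun x => ?_)
  rw [Real.norm_of_nonneg (by positivity)]
  simp only [Pi.add_apply]
  rcases le_total ‖x‖ 1 with hx | hx
  · have := Real.rpow_nonneg (norm_nonneg x) q
    nlinarith [norm_nonneg x]
  · have := Real.rpow_le_rpow_of_exponent_le hx hq.le
    rw [Real.rpow_two] at this
    linarith

lemma integrable_id_of_integrable_norm_sq [SecondCountableTopology E]
    (h : Integrable (fun x : E => ‖x‖ ^ 2) μ) :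
    Integrable (fun x : E => x) μ := by
  refine ((integrable_const 1).add h).mono' (by fun_prop) (ae_of_all _ fun x => ?_)
  simp only [Pi.add_apply]
  nlinarith [sq_nonneg (‖x‖ - 1), norm_nonneg x]

end Moments

section Measure

variable {E : Type*} [NormedAddCommGroup E] [InnerProductSpace ℝ E] [MeasurableSpace E]
  [BorelSpace E] {μ : Measure E} [IsFiniteMeasure μ]

lemma integrable_norm_sq_perpPart_sub {e : E} (he : ‖e‖ = 1) (v : E)
    (h : Integrable (fun x : E => ‖x‖ ^ 2) μ) :
    Integrable (fun x => ‖perpPart e (x - v)‖ ^ 2) μ := by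
  refine ((h.const_mul 2).add (integrable_const (2 * ‖perpPart e v‖ ^ 2))).mono' ?_
    (ae_of_all _ fun x => ?_)
  · have := continuous_perpPart e
    exact Continuous.aestronglyMeasurable (by fun_prop)
  · rw [Real.norm_of_nonneg (by positivity)]
    exact norm_sq_perpPart_sub_le he x v

lemma integrable_inner_sub_sq (e v : E) (h : Integrable (fun x : E => ‖x‖ ^ 2) μ) :
    Integrable (fun x => ⟪x - v, e⟫ ^ 2) μ := by
  refine (((h.const_mul 2).add (integrable_const (2 * ‖v‖ ^ 2))).mul_const (‖e‖ ^ 2)).mono'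
    (Continuous.aestronglyMeasurable (by fun_prop)) (ae_of_all _ fun x => ?_)
  rw [Real.norm_of_nonneg (by positivity)]
  simp only [Pi.add_apply]
  have h1 : ⟪x - v, e⟫ ^ 2 ≤ (‖x - v‖ * ‖e‖) ^ 2 := by
    rw [← sq_abs]
    gcongr
    exact abs_real_inner_le_norm _ _
  have h2 : ‖x - v‖ ^ 2 ≤ 2 * ‖x‖ ^ 2 + 2 * ‖v‖ ^ 2 := by
    nlinarith [norm_sub_le x v, norm_nonneg (x - v), sq_nonneg (‖x‖ - ‖v‖), norm_nonneg x,
      norm_nonneg v]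
  calc _ ≤ ‖x - v‖ ^ 2 * ‖e‖ ^ 2 := by rw [← mul_pow]; exact h1
    _ ≤ _ := by gcongr

/-- The second moment in a given direction is minimal about the mean. -/
lemma integral_inner_sub_average_sq_le [SecondCountableTopology E] [CompleteSpace E]
    (e v : E) (h : Integrable (fun x : E => ‖x‖ ^ 2) μ) (hμ : μ ≠ 0) :
    ∫ x, ⟪x - ⨍ y, y ∂μ, e⟫ ^ 2 ∂μ ≤ ∫ x, ⟪x - v, e⟫ ^ 2 ∂μ := by
  set m : E := ⨍ y, y ∂μ with hm
  have hid := integrable_id_of_integrable_norm_sq h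
  have hlin : Integrable (fun x => ⟪x - m, e⟫) μ := (hid.sub (integrable_const m)).inner_const e
  have hzero : ∫ x, ⟪x - m, e⟫ ∂μ = 0 := by
    have h0 : ∫ x, (x - m) ∂μ = 0 := by
      have : NeZero μ := ⟨hμ⟩
      rw [hm]
      exact integral_sub_average μ _
    simp_rw [real_inner_comm e]
    have hinner := integral_inner (𝕜 := ℝ) (hid.sub (integrable_const m)) e
    simp only [Pi.sub_apply] at hinner
    rw [hinner, h0, inner_zero_right]
  have hle : ∫ x, (⟪x - m, e⟫ ^ 2 + 2 * ⟪m - v, e⟫ * ⟪x - m, e⟫) ∂μ ≤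
      ∫ x, ⟪x - v, e⟫ ^ 2 ∂μ := by
    refine integral_mono ((integrable_inner_sub_sq e m h).add (hlin.const_mul _))
      (integrable_inner_sub_sq e v h) fun x => ?_
    have : ⟪x - v, e⟫ = ⟪x - m, e⟫ + ⟪m - v, e⟫ := by
      rw [← inner_add_left, sub_add_sub_cancel]
    simp only [this]
    nlinarith [sq_nonneg ⟪m - v, e⟫]
  rwa [integral_add (integrable_inner_sub_sq e m h) (hlin.const_mul _), integral_const_mul,
    hzero, mul_zero, add_zero] at hle

/-- Points of a ball that stay away from the line `v + ℝ e`. -/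
def awaySet {E : Type*} [NormedAddCommGroup E] [InnerProductSpace ℝ E] (R δ : ℝ) (e v : E) :
    Set E :=
  {x | ‖x‖ ≤ R ∧ δ ≤ ‖perpPart e (x - v)‖ ^ 2}

lemma measurableSet_awaySet (R δ : ℝ) (e v : E) : MeasurableSet (awaySet R δ e v) := by
  have := continuous_perpPart e
  exact ((isClosed_le continuous_norm continuous_const).inter
    (isClosed_le continuous_const
      ((this.comp (continuous_sub_right v)).norm.pow 2))).measurableSet

/-- Case of a line close to the origin: the transversal second moment forces mass away from it. -/
lemma measure_awaySet_of_norm_perpPart_le {e v : E} (he : ‖e‖ = 1) {q R δ K : ℝ} (hq : 2 < q)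
    (hR : 1 ≤ R) (hδ : 0 < δ) (h : Integrable (fun x : E => ‖x‖ ^ q) μ)
    (hK : ‖perpPart e v‖ ≤ K) :
    ∫ x, ‖perpPart e (x - v)‖ ^ 2 ∂μ ≤ δ * μ.real univ +
      (2 * R ^ 2 + 2 * K ^ 2) * μ.real (awaySet R δ e v) +
      (2 * R ^ (2 - q) + 2 * K ^ 2 * R ^ (-q)) * ∫ x, ‖x‖ ^ q ∂μ := by
  have hS := measurableSet_awaySet R δ e v
  have hi1 : Integrable (fun _ : E => δ) μ := integrable_const δ
  have hi2 : Integrable (fun x => (2 * R ^ 2 + 2 * K ^ 2) *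
      (awaySet R δ e v).indicator (fun _ => (1 : ℝ)) x) μ :=
    ((integrable_const 1).indicator hS).const_mul _
  have hi3 := h.const_mul (2 * R ^ (2 - q) + 2 * K ^ 2 * R ^ (-q))
  have hR0 : 0 < R := by linarith
  have hle := integral_mono (integrable_norm_sq_perpPart_sub he v
      (integrable_norm_sq_of_integrable_norm_rpow hq h)) ((hi1.add hi2).add hi3) (fun x => by
    simp only [Pi.add_apply]
    have hd := norm_sq_perpPart_sub_le he x v
    have hK2 : ‖perpPart e v‖ ^ 2 ≤ K ^ 2 := by gcongr
    have ht : 0 ≤ (2 * R ^ (2 - q) + 2 * K ^ 2 * R ^ (-q)) * ‖x‖ ^ q := by positivity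
    by_cases hx : ‖x‖ ≤ R
    · by_cases hxd : δ ≤ ‖perpPart e (x - v)‖ ^ 2
      · have hmem : x ∈ awaySet R δ e v := ⟨hx, hxd⟩
        rw [indicator_of_mem hmem]
        have : ‖x‖ ^ 2 ≤ R ^ 2 := by gcongr
        linarith
      · have hmem : x ∉ awaySet R δ e v := fun h' => hxd h'.2
        rw [indicator_of_notMem hmem]
        linarith
    · have hmem : x ∉ awaySet R δ e v := fun h' => hx h'.1
      rw [indicator_of_notMem hmem]
      push Not at hx
      have hx0 : 0 < ‖x‖ := hR0.trans hx
      have e1 : ‖x‖ ^ 2 ≤ R ^ (2 - q) * ‖x‖ ^ q := by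
        have : ‖x‖ ^ (2 - q) ≤ R ^ (2 - q) :=
          Real.rpow_le_rpow_of_nonpos hR0 hx.le (by linarith)
        calc ‖x‖ ^ 2 = ‖x‖ ^ (2 - q) * ‖x‖ ^ q := by
              rw [← Real.rpow_add hx0, sub_add_cancel, Real.rpow_two]
          _ ≤ _ := by gcongr
      have e2 : 1 ≤ R ^ (-q) * ‖x‖ ^ q := by
        have : ‖x‖ ^ (-q) ≤ R ^ (-q) :=
          Real.rpow_le_rpow_of_nonpos hR0 hx.le (by linarith)
        calc 1 = ‖x‖ ^ (-q) * ‖x‖ ^ q := by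
              rw [← Real.rpow_add hx0, neg_add_cancel, Real.rpow_zero]
          _ ≤ _ := by gcongr
      nlinarith [mul_le_mul_of_nonneg_left e2 (sq_nonneg K)])
  rw [integral_add' (hi1.add hi2) hi3, integral_add' hi1 hi2, integral_const, integral_const_mul,
    integral_const_mul, integral_indicator_const _ hS] at hle
  simpa [mul_comm] using hle

/-- Case of a line far from the origin: most of the mass is away from it. -/
lemma measure_awaySet_of_lt_norm_perpPart {e v : E} (he : ‖e‖ = 1) {q R δ ρ : ℝ} (hq : 2 < q)
    (hρ : 1 ≤ ρ) (hρR : ρ ≤ R) (hδ : δ ≤ 1) (h : Integrable (fun x : E => ‖x‖ ^ q) μ)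
    (hv : 2 * ρ < ‖perpPart e v‖) :
    μ.real univ ≤ μ.real (awaySet R δ e v) + ρ ^ (-q) * ∫ x, ‖x‖ ^ q ∂μ := by
  have hS := measurableSet_awaySet R δ e v
  have hi2 : Integrable (fun x => (awaySet R δ e v).indicator (fun _ => (1 : ℝ)) x) μ :=
    (integrable_const 1).indicator hS
  have hi3 := h.const_mul (ρ ^ (-q))
  have hρ0 : 0 < ρ := by linarith
  have hle := integral_mono (integrable_const (1 : ℝ)) (hi2.add hi3) (fun x => by
    simp only [Pi.add_apply]
    have ht : 0 ≤ ρ ^ (-q) * ‖x‖ ^ q := by positivity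
    by_cases hx : ‖x‖ ≤ ρ
    · have hmem : x ∈ awaySet R δ e v := by
        refine ⟨hx.trans hρR, ?_⟩
        have := sub_le_norm_perpPart_sub he x v
        nlinarith
      rw [indicator_of_mem hmem]
      linarith
    · push Not at hx
      have hx0 : 0 < ‖x‖ := hρ0.trans hx
      have e2 : 1 ≤ ρ ^ (-q) * ‖x‖ ^ q := by
        have : ‖x‖ ^ (-q) ≤ ρ ^ (-q) :=
          Real.rpow_le_rpow_of_nonpos hρ0 hx.le (by linarith)
        calc 1 = ‖x‖ ^ (-q) * ‖x‖ ^ q := by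
              rw [← Real.rpow_add hx0, neg_add_cancel, Real.rpow_zero]
          _ ≤ _ := by gcongr
      have : 0 ≤ (awaySet R δ e v).indicator (fun _ => (1 : ℝ)) x :=
        indicator_nonneg (fun _ _ => zero_le_one) x
      linarith)
  rw [integral_add' hi2 hi3, integral_const, integral_const_mul,
    integral_indicator_const _ hS] at hle
  simpa using hle

end Measure

lemma exists_uniform_measure_awaySet {m₀ M₀ p Mq q : ℝ} (hm₀ : 0 < m₀) (hM₀ : 0 < M₀)
    (hp : 0 < p) (hMq : 0 < Mq) (hq : 2 < q) :
    ∃ R δ c : ℝ, 1 ≤ R ∧ 0 < δ ∧ δ ≤ 1 ∧ 0 < c ∧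
      ∀ {E : Type} [NormedAddCommGroup E] [InnerProductSpace ℝ E] [MeasurableSpace E]
        [BorelSpace E] (μ : Measure E) [IsFiniteMeasure μ],
        m₀ ≤ μ.real univ → μ.real univ ≤ M₀ → Integrable (fun x : E => ‖x‖ ^ q) μ →
        ∫ x, ‖x‖ ^ q ∂μ ≤ Mq → ∀ e v : E, ‖e‖ = 1 →
        p ≤ ∫ x, ‖perpPart e (x - v)‖ ^ 2 ∂μ → c ≤ μ.real (awaySet R δ e v) := by
  have tneg : ∀ s : ℝ, 0 < s → Filter.Tendsto (fun x : ℝ => x ^ (-s)) Filter.atTop (nhds 0) :=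
    fun s hs => tendsto_rpow_neg_atTop hs
  obtain ⟨ρ, hρ, hρ1⟩ := (((tneg q (by linarith)).eventually
    (gt_mem_nhds (show 0 < m₀ / (2 * Mq) by positivity))).and
      (Filter.eventually_ge_atTop 1)).exists
  have ht : Filter.Tendsto (fun x : ℝ => 2 * x ^ (2 - q) + 2 * (2 * ρ) ^ 2 * x ^ (-q))
      Filter.atTop (nhds 0) := by
    have h1 := (tneg (q - 2) (by linarith)).const_mul 2
    have h2 := (tneg q (by linarith)).const_mul (2 * (2 * ρ) ^ 2)
    simpa using h1.add h2
  obtain ⟨R, hR, hρR⟩ := ((ht.eventually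
    (gt_mem_nhds (show 0 < p / (4 * Mq) by positivity))).and
      (Filter.eventually_ge_atTop ρ)).exists
  have hD : 0 < 2 * R ^ 2 + 2 * (2 * ρ) ^ 2 := by positivity
  refine ⟨R, min 1 (p / (4 * M₀)), min (m₀ / 2) (p / (2 * (2 * R ^ 2 + 2 * (2 * ρ) ^ 2))),
    hρ1.trans hρR, by positivity, min_le_left _ _, by positivity, ?_⟩
  intro E _ _ _ _ μ _ hm hM hint hq' e v he hpe
  have hI : 0 ≤ ∫ x, ‖x‖ ^ q ∂μ := integral_nonneg fun x => by positivity
  rcases le_or_gt ‖perpPart e v‖ (2 * ρ) with h | h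
  · refine (min_le_right _ _).trans ?_
    have key := measure_awaySet_of_norm_perpPart_le (δ := min 1 (p / (4 * M₀))) he hq
      (hρ1.trans hρR) (by positivity) hint h
    have h1 : min 1 (p / (4 * M₀)) * μ.real univ ≤ p / 4 :=
      calc _ ≤ p / (4 * M₀) * M₀ := by gcongr; exact min_le_right _ _
        _ = p / 4 := by field_simp
    have h2 : (2 * R ^ (2 - q) + 2 * (2 * ρ) ^ 2 * R ^ (-q)) * ∫ x, ‖x‖ ^ q ∂μ ≤ p / 4 :=
      calc _ ≤ p / (4 * Mq) * Mq := by gcongr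
        _ = p / 4 := by field_simp
    rw [div_le_iff₀ (by positivity)]
    linarith
  · refine (min_le_left _ _).trans ?_
    have key := measure_awaySet_of_lt_norm_perpPart (δ := min 1 (p / (4 * M₀))) he hq hρ1 hρR
      (min_le_left _ _) hint h
    have h2 : ρ ^ (-q) * ∫ x, ‖x‖ ^ q ∂μ ≤ m₀ / 2 :=
      calc _ ≤ m₀ / (2 * Mq) * Mq := by gcongr
        _ = m₀ / 2 := by field_simp
    linarith

lemma ofReal_le_lintegral_of_le_measure_awaySet {E : Type*} [NormedAddCommGroup E]
    [InnerProductSpace ℝ E] [MeasurableSpace E] [BorelSpace E] (μ : Measure E) [IsFiniteMeasure μ]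
    {e : E} (v : E) (he : ‖e‖ = 1) {R δ c : ℝ} (γ : ℝ) (hR : 1 ≤ R) (hδ : 0 < δ) (hδ1 : δ ≤ 1)
    (hc : c ≤ μ.real (awaySet R δ e v)) :
    ENNReal.ofReal (c * δ * min ((δ / (4 + 8 * R)) ^ γ) (R ^ γ) * (1 + ‖v‖) ^ γ) ≤
      ∫⁻ x, ENNReal.ofReal (‖perpPart e (x - v)‖ ^ 2 * ‖x - v‖ ^ γ) ∂μ := by
  have hR0 : 0 < R := by linarith
  set B := min ((δ / (4 + 8 * R)) ^ γ) (R ^ γ) * (1 + ‖v‖) ^ γ with hB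
  have hB0 : 0 ≤ B := by positivity
  have hS := measurableSet_awaySet R δ e v
  calc _ ≤ ENNReal.ofReal (δ * B * μ.real (awaySet R δ e v)) := by
        apply ENNReal.ofReal_le_ofReal
        calc _ = δ * B * c := by rw [hB]; ring
          _ ≤ _ := by gcongr
    _ = ∫⁻ _ in awaySet R δ e v, ENNReal.ofReal (δ * B) ∂μ := by
        rw [setLIntegral_const, ENNReal.ofReal_mul (by positivity), ofReal_measureReal]
    _ ≤ ∫⁻ x in awaySet R δ e v,
          ENNReal.ofReal (‖perpPart e (x - v)‖ ^ 2 * ‖x - v‖ ^ γ) ∂μ := by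
        refine setLIntegral_mono' hS fun x hx => ENNReal.ofReal_le_ofReal ?_
        exact mul_le_mul hx.2 (min_rpow_mul_le_norm_sub_rpow he γ hR hδ hδ1 hx.1 hx.2) hB0
          (by positivity)
    _ ≤ _ := setLIntegral_le_lintegral _ _

section Density

variable {n : ℕ} {f : En n → ℝ}

/-- The measure with density `f`. -/
def densityMeasure (f : En n → ℝ) : Measure (En n) :=
  volume.withDensity fun v => ENNReal.ofReal (f v)

lemma lintegral_densityMeasure (hf : Measurable f) (hf0 : ∀ v, 0 ≤ f v) {g : En n → ℝ}
    (hg : Measurable g) :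
    ∫⁻ x, ENNReal.ofReal (g x) ∂(densityMeasure f) = ∫⁻ x, ENNReal.ofReal (f x * g x) := by
  rw [densityMeasure, lintegral_withDensity_eq_lintegral_mul _ hf.ennreal_ofReal
    hg.ennreal_ofReal]
  simp_rw [Pi.mul_apply, ← ENNReal.ofReal_mul (hf0 _)]

lemma densityMeasure_univ : densityMeasure f univ = ∫⁻ v, ENNReal.ofReal (f v) := by
  rw [densityMeasure, withDensity_apply _ MeasurableSet.univ, Measure.restrict_univ]

lemma vbar_eq_average (hf : Measurable f) (hf0 : ∀ v, 0 ≤ f v) :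
    vbar f = ⨍ x, x ∂(densityMeasure f) := by
  rw [average_eq, vbar]
  congr 1
  · rw [Measure.real, densityMeasure_univ, integral_eq_lintegral_of_nonneg_ae
      (ae_of_all _ hf0) hf.aestronglyMeasurable]
  · rw [densityMeasure, integral_withDensity_eq_integral_toReal_smul hf.ennreal_ofReal
      (ae_of_all _ fun x => ENNReal.ofReal_lt_top)]
    simp_rw [ENNReal.toReal_ofReal (hf0 _)]

lemma lintegral_pressure_eq (hf : Measurable f) (hf0 : ∀ v, 0 ≤ f v) (e : En n) :
    ∫⁻ w, ENNReal.ofReal (f (vbar f + w) * ⟪w, e⟫ ^ 2) =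
      ∫⁻ x, ENNReal.ofReal (⟪x - vbar f, e⟫ ^ 2) ∂(densityMeasure f) := by
  rw [lintegral_densityMeasure hf hf0 (by fun_prop),
    ← lintegral_add_left_eq_self (μ := volume)
      (fun x => ENNReal.ofReal (f x * ⟪x - vbar f, e⟫ ^ 2)) (vbar f)]
  simp

lemma lintegral_landau_eq (hf : Measurable f) (hf0 : ∀ v, 0 ≤ f v) (γ : ℝ) (v : En n) {e : En n}
    (he : ‖e‖ = 1) (hn : n ≠ 0) :
    ∫⁻ w, ENNReal.ofReal ((1 - ⟪w, e⟫ ^ 2 / ‖w‖ ^ 2) * ‖w‖ ^ (γ + 2) * f (v - w)) =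
      ∫⁻ x, ENNReal.ofReal (‖perpPart e (x - v)‖ ^ 2 * ‖x - v‖ ^ γ) ∂(densityMeasure f) := by
  have : Nonempty (Fin n) := ⟨⟨0, Nat.pos_of_ne_zero hn⟩⟩
  have hcont := (continuous_perpPart e).measurable
  rw [lintegral_densityMeasure hf hf0 (by fun_prop),
    ← lintegral_sub_left_eq_self (μ := volume) (fun x => ENNReal.ofReal
      (f x * (‖perpPart e (x - v)‖ ^ 2 * ‖x - v‖ ^ γ))) v]
  have hne : ∀ᵐ w : En n, w ≠ 0 := by simp [ae_iff]
  refine lintegral_congr_ae (hne.mono fun w hw => ?_)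
  have hw' : 0 < ‖w‖ := norm_pos_iff.2 hw
  simp only [sub_sub_cancel_left]
  congr 1
  rw [norm_sq_perpPart he, norm_neg, inner_neg_left, Real.rpow_add hw', Real.rpow_two]
  field_simp

lemma le_integral_norm_sq_perpPart [IsFiniteMeasure (densityMeasure f)] (hf : Measurable f)
    (hf0 : ∀ v, 0 ≤ f v) (hμ : densityMeasure f ≠ 0) {p₀ : ℝ} (hp₀ : 0 < p₀)
    (hp : PressureLB f p₀) (h : Integrable (fun x : En n => ‖x‖ ^ 2) (densityMeasure f))
    {e : En n} (he : ‖e‖ = 1) (v : En n) :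
    p₀ / 2 ≤ ∫ x, ‖perpPart e (x - v)‖ ^ 2 ∂(densityMeasure f) := by
  obtain ⟨e', he', hort, hle⟩ := hp e he (p₀ / 2) (by positivity)
  rw [lintegral_pressure_eq hf hf0, ← ofReal_integral_eq_lintegral_ofReal
    (integrable_inner_sub_sq e' _ h) (ae_of_all _ fun x => sq_nonneg _),
    ENNReal.ofReal_le_ofReal_iff (integral_nonneg fun x => sq_nonneg _),
    vbar_eq_average hf hf0] at hle
  calc p₀ / 2 = p₀ - p₀ / 2 := by ring
    _ ≤ _ := hle
    _ ≤ _ := integral_inner_sub_average_sq_le e' v h hμ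
    _ ≤ _ := integral_mono (integrable_inner_sub_sq e' v h)
        (integrable_norm_sq_perpPart_sub he v h)
        fun x => inner_sq_le_norm_sq_perpPart he' hort (x - v)

end Density

/-- estimate \eqref{eq:unif-ell-Landau-1} in Lemma 7.1 of the paper: lower
ellipticity bound for the Landau diffusion matrix. Under mass, pressure, and `q`-moment bounds
(`q > 2`), for every `v ∈ ℝⁿ` and unit `e`,
`e·A(v)e = ∫ (1 - (w·e)²/|w|²) |w|^{γ+2} f(v-w) dw ≥ λ (1+|v|)^γ`, with `λ` depending only on
`n, m₀, M₀, p₀, M_q, q, γ`. -/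
theorem stmt17 (n : ℕ) (hn : 2 ≤ n) (γ m₀ M₀ p₀ Mq q : ℝ)
    (hγ : -(n : ℝ) < γ) (hm₀ : 0 < m₀) (hp₀ : 0 < p₀) (hq : 2 < q) :
    ∃ lam : ℝ, 0 < lam ∧
      ∀ f : En n → ℝ, Measurable f → (∀ v, 0 ≤ f v) →
        MassBound f m₀ M₀ → PressureLB f p₀ → MomentBound f q Mq →
        ∀ (v e : En n), ‖e‖ = 1 →
          ENNReal.ofReal (lam * (1 + ‖v‖) ^ γ) ≤
            ∫⁻ w, ENNReal.ofReal
              ((1 - ⟪w, e⟫ ^ 2 / ‖w‖ ^ 2) * ‖w‖ ^ (γ + 2) * f (v - w)) := by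
  by_cases hM₀ : 0 < M₀
  swap
  · refine ⟨1, one_pos, fun f _ _ hmass => ?_⟩
    have := hmass.1.trans hmass.2
    rw [ENNReal.ofReal_of_nonpos (not_lt.1 hM₀), nonpos_iff_eq_zero,
      ENNReal.ofReal_eq_zero] at this
    linarith
  obtain ⟨R, δ, c, hR, hδ, hδ1, hc, key⟩ := exists_uniform_measure_awaySet hm₀ hM₀
    (half_pos hp₀) (lt_max_of_lt_right one_pos : 0 < max Mq 1) hq
  have hR0 : 0 < R := by linarith
  refine ⟨c * δ * min ((δ / (4 + 8 * R)) ^ γ) (R ^ γ), by positivity, ?_⟩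
  intro f hf hf0 hmass hpres hmom v e he
  have hmass' := hmass
  rw [MassBound, ← densityMeasure_univ] at hmass'
  have : IsFiniteMeasure (densityMeasure f) := ⟨hmass'.2.trans_lt ENNReal.ofReal_lt_top⟩
  have hml : m₀ ≤ (densityMeasure f).real univ :=
    (ENNReal.ofReal_le_iff_le_toReal (measure_ne_top _ _)).1 hmass'.1
  have hmu : (densityMeasure f).real univ ≤ M₀ := ENNReal.toReal_le_of_le_ofReal hM₀.le hmass'.2
  have hμ : densityMeasure f ≠ 0 := by
    intro h0
    simp [h0] at hml
    linarith
  have hmom' : ∫⁻ x, ENNReal.ofReal (‖x‖ ^ q) ∂(densityMeasure f) ≤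
      ENNReal.ofReal (max Mq 1) := by
    rw [lintegral_densityMeasure hf hf0 (by fun_prop)]
    exact hmom.trans (ENNReal.ofReal_le_ofReal (le_max_left _ _))
  have hnn : 0 ≤ᵐ[densityMeasure f] fun x : En n => ‖x‖ ^ q :=
    ae_of_all _ fun x => Real.rpow_nonneg (norm_nonneg x) q
  have hmeas : AEStronglyMeasurable (fun x : En n => ‖x‖ ^ q) (densityMeasure f) :=
    Measurable.aestronglyMeasurable (by fun_prop)
  have hint : Integrable (fun x : En n => ‖x‖ ^ q) (densityMeasure f) :=
    ⟨hmeas, (hasFiniteIntegral_iff_ofReal hnn).2 (hmom'.trans_lt ENNReal.ofReal_lt_top)⟩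
  have hIq : ∫ x, ‖x‖ ^ q ∂(densityMeasure f) ≤ max Mq 1 := by
    rw [integral_eq_lintegral_of_nonneg_ae hnn hmeas]
    exact ENNReal.toReal_le_of_le_ofReal (by positivity) hmom'
  rw [lintegral_landau_eq hf hf0 γ v he (by omega)]
  exact ofReal_le_lintegral_of_le_measure_awaySet _ v he γ hR hδ hδ1
    (key _ hml hmu hint hIq e v he (le_integral_norm_sq_perpPart hf hf0 hμ hp₀ hpres
      (integrable_norm_sq_of_integrable_norm_rpow hq hint) he v))
end
end

section
/- Let n ≥ 2, γ > −n, and q > 2. Assume f : ℝⁿ → [0,∞) is measurable and satisfies: the mass bound m₀ ≤ ∫_{ℝⁿ} f(v) dv ≤ M₀; the pressure lower bound inf_{σ ∈ S^{n-1}} sup_{e ∈ S^{n-1}, e ⊥ σ} ∫_{ℝⁿ} f(v̄ + w) |w·e|² dw ≥ p₀ > 0, where v̄ := (∫_{ℝⁿ} f(v) v dv)/(∫_{ℝⁿ} f(v) dv); and the moment bound ∫_{ℝⁿ} f(v) |v|^q dv ≤ M_q. Then there exists λ > 0, depending only on n, m₀, M₀, p₀, M_q, q, γ (independent of v₀), such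 that for every v₀ ∈ ℝⁿ, every v in the ball B₂ of radius 2 centered at the origin, and every e ∈ S^{n-1}: e · Ã(v) e ≥ λ, where Ã is the transformed Landau diffusion matrix associated to f and v₀. -/
open MeasureTheory Metric Set
open scoped ENNReal RealInnerProductSpace NNReal

noncomputable section

/-- The change of variables `τ₀`: for `|v₀| ≥ 2` it maps `a v₀ + w ↦ (a/|v₀|) v₀ + w`
(for `w ⊥ v₀`); for `|v₀| < 2` it is the identity. -/
def tau0 {n : ℕ} (v₀ : En n) (u : En n) : En n :=
  if 2 ≤ ‖v₀‖ then u + ((1 / ‖v₀‖ - 1) * (⟪u, v₀⟫ / ‖v₀‖ ^ 2)) • v₀ else u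

/-- The inverse `τ₀⁻¹` of `τ₀`: for `|v₀| ≥ 2` it maps `a v₀ + w ↦ (a|v₀|) v₀/|v₀| ⋯`,
i.e. `a v₀ + w ↦ a‖v₀‖ v₀ + w` in the decomposition `u = a v₀ + w` with `w ⊥ v₀`;
for `|v₀| < 2` it is the identity. -/
def tau0inv {n : ℕ} (v₀ : En n) (u : En n) : En n :=
  if 2 ≤ ‖v₀‖ then u + ((‖v₀‖ - 1) * (⟪u, v₀⟫ / ‖v₀‖ ^ 2)) • v₀ else u

/-- The quadratic form of the Landau diffusion matrix
`A(v) = ∫ (I - ŵ⊗ŵ) |w|^{γ+2} f(v-w) dw` (with the dimensional constant normalized to `1`),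
evaluated at a vector `a`:
`a·A(v)a = ∫ (|a|² - (w·a)²/|w|²) |w|^{γ+2} f(v-w) dw`, valued in `[0,∞]`. -/
def landauQF (n : ℕ) (γ : ℝ) (f : En n → ℝ) (v a : En n) : ℝ≥0∞ :=
  ∫⁻ w, ENNReal.ofReal ((‖a‖ ^ 2 - ⟪w, a⟫ ^ 2 / ‖w‖ ^ 2) * ‖w‖ ^ (γ + 2) * f (v - w))

/-- The quadratic form `e·Ã(v)e` of the transformed Landau diffusion matrix
`Ã(v)e = |v₀|^{-γ-2} τ₀⁻¹(A(v₀+τ₀(v)) τ₀⁻¹(e))` for `|v₀| ≥ 2` (using that `τ₀⁻¹` is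
self-adjoint, `e·Ã(v)e = |v₀|^{-γ-2} (τ₀⁻¹e)·A(v₀+τ₀(v))(τ₀⁻¹e)`), and
`Ã(v) = A(v₀+v)` for `|v₀| < 2`. -/
def landauQFtilde (n : ℕ) (γ : ℝ) (f : En n → ℝ) (v₀ v e : En n) : ℝ≥0∞ :=
  if 2 ≤ ‖v₀‖ then
    ENNReal.ofReal (‖v₀‖ ^ (-γ - 2)) * landauQF n γ f (v₀ + tau0 v₀ v) (tau0inv v₀ e)
  else landauQF n γ f (v₀ + v) e


/-- The integrand `(|a|² - (w·a)²/|w|²) |w|^{γ+2}` of the Landau quadratic form. -/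
def landauKernel {n : ℕ} (γ : ℝ) (a w : En n) : ℝ :=
  (‖a‖ ^ 2 - ⟪w, a⟫ ^ 2 / ‖w‖ ^ 2) * ‖w‖ ^ (γ + 2)

lemma measurable_landauKernel {n : ℕ} (γ : ℝ) (a : En n) :
    Measurable (landauKernel γ a) := by
  unfold landauKernel
  fun_prop

/-- The squared area of the parallelogram spanned by `w` and `a` dominates the squared area of
its projection to the plane of an orthonormal pair `ξ, η`. -/
lemma sq_area_le {n : ℕ} (w a ξ η : En n) (hξ : ‖ξ‖ = 1) (hη : ‖η‖ = 1) (hξη : ⟪ξ, η⟫ = 0) :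
    (⟪w, ξ⟫ * ⟪a, η⟫ - ⟪w, η⟫ * ⟪a, ξ⟫) ^ 2 ≤ ‖w‖ ^ 2 * ‖a‖ ^ 2 - ⟪w, a⟫ ^ 2 := by
  rcases eq_or_ne w 0 with rfl | hw
  · simp
  have hw2 : 0 < ‖w‖ ^ 2 := by positivity
  have hηξ : ⟪η, ξ⟫ = 0 := by rw [real_inner_comm]; exact hξη
  have hξξ : ⟪ξ, ξ⟫ = 1 := by rw [real_inner_self_eq_norm_sq, hξ]; norm_num
  have hηη : ⟪η, η⟫ = 1 := by rw [real_inner_self_eq_norm_sq, hη]; norm_num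
  set p : En n := ⟪w, ξ⟫ • η - ⟪w, η⟫ • ξ with hp
  set b : En n := a - (⟪w, a⟫ / ‖w‖ ^ 2) • w with hb
  have hpw : ⟪p, w⟫ = 0 := by
    simp only [hp, inner_sub_left, inner_smul_left, conj_trivial]
    rw [real_inner_comm w η, real_inner_comm w ξ]; ring
  have hpb : ⟪p, b⟫ = ⟪w, ξ⟫ * ⟪a, η⟫ - ⟪w, η⟫ * ⟪a, ξ⟫ := by
    rw [hb, inner_sub_right, inner_smul_right, hpw]
    simp only [hp, inner_sub_left, inner_smul_left, conj_trivial]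
    rw [real_inner_comm a η, real_inner_comm a ξ]; ring
  have hpn : ‖p‖ ^ 2 = ⟪w, ξ⟫ ^ 2 + ⟪w, η⟫ ^ 2 := by
    rw [← real_inner_self_eq_norm_sq]
    simp only [hp, inner_sub_left, inner_sub_right, inner_smul_left, inner_smul_right,
      conj_trivial, hξη, hηξ, hξξ, hηη]
    ring
  have hpw' : ‖p‖ ^ 2 ≤ ‖w‖ ^ 2 := by
    have h := sq_nonneg ‖w - ⟪w, ξ⟫ • ξ - ⟪w, η⟫ • η‖
    rw [← real_inner_self_eq_norm_sq] at h
    simp only [inner_sub_left, inner_sub_right, inner_smul_left, inner_smul_right,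
      conj_trivial, hξη, hηξ, hξξ, hηη, real_inner_comm w ξ, real_inner_comm w η,
      real_inner_self_eq_norm_sq] at h
    rw [hpn]
    linarith
  have hbn : ‖w‖ ^ 2 * ‖b‖ ^ 2 = ‖w‖ ^ 2 * ‖a‖ ^ 2 - ⟪w, a⟫ ^ 2 := by
    rw [hb, norm_sub_sq_real, inner_smul_right, norm_smul, mul_pow, Real.norm_eq_abs, sq_abs,
      real_inner_comm w a]
    field_simp
    ring
  calc _ = ⟪p, b⟫ ^ 2 := by rw [hpb]
    _ ≤ (‖p‖ * ‖b‖) ^ 2 := by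
        rw [← sq_abs]
        gcongr
        exact abs_real_inner_le_norm p b
    _ = ‖p‖ ^ 2 * ‖b‖ ^ 2 := by ring
    _ ≤ ‖w‖ ^ 2 * ‖b‖ ^ 2 := by gcongr
    _ = _ := hbn

lemma mul_sq_area_le_landauKernel {n : ℕ} (γ : ℝ) (w a ξ η : En n) (hξ : ‖ξ‖ = 1)
    (hη : ‖η‖ = 1) (hξη : ⟪ξ, η⟫ = 0) (hw : w ≠ 0) :
    ‖w‖ ^ γ * (⟪w, ξ⟫ * ⟪a, η⟫ - ⟪w, η⟫ * ⟪a, ξ⟫) ^ 2 ≤ landauKernel γ a w := by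
  have hw0 : 0 < ‖w‖ := by positivity
  have h := sq_area_le w a ξ η hξ hη hξη
  have e : landauKernel γ a w = ‖w‖ ^ γ * (‖w‖ ^ 2 * ‖a‖ ^ 2 - ⟪w, a⟫ ^ 2) := by
    rw [landauKernel, Real.rpow_add hw0, Real.rpow_two]
    field_simp
  rw [e]
  gcongr

lemma min_rpow_le_rpow {r s x : ℝ} (t : ℝ) (hr : 0 < r) (hrx : r ≤ x) (hxs : x ≤ s) :
    min (r ^ t) (s ^ t) ≤ x ^ t := by
  rcases le_total 0 t with ht | ht
  · exact (min_le_left _ _).trans (Real.rpow_le_rpow hr.le hrx ht)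
  · exact (min_le_right _ _).trans (Real.rpow_le_rpow_of_nonpos (hr.trans_le hrx) hxs ht)

/-- Nonnegative finite measures with bounded mass, controlled `q`-th moment, and variance at
least `p` in some direction orthogonal to any given one. -/
structure Admissible {n : ℕ} (m M p Q q : ℝ) (μ : Measure (En n)) : Prop where
  finite : IsFiniteMeasure μ
  mass_ge : m ≤ μ.real univ
  mass_le : μ.real univ ≤ M
  integrable_rpow : Integrable (fun v => ‖v‖ ^ q) μ
  moment_le : ∫ v, ‖v‖ ^ q ∂μ ≤ Q
  variance_ge : ∀ σ : En n, ‖σ‖ = 1 → ∃ η : En n, ‖η‖ = 1 ∧ ⟪σ, η⟫ = 0 ∧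
    ∀ c : ℝ, p ≤ ∫ v, (⟪v, η⟫ - c) ^ 2 ∂μ

lemma integrable_one_add_sq {n : ℕ} {q : ℝ} (hq : 2 < q) {μ : Measure (En n)}
    [IsFiniteMeasure μ] (h : Integrable (fun v => ‖v‖ ^ q) μ) :
    Integrable (fun v => 1 + ‖v‖ ^ 2) μ := by
  refine ((integrable_const (2 : ℝ)).add h).mono' (by fun_prop) (ae_of_all _ fun v => ?_)
  rw [Real.norm_of_nonneg (by positivity)]
  simp only [Pi.add_apply]
  have h0 : 0 ≤ ‖v‖ ^ q := by positivity
  rcases le_total ‖v‖ 1 with h1 | h1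
  · nlinarith [norm_nonneg v]
  · have := Real.rpow_le_rpow_of_exponent_le h1 hq.le
    rw [Real.rpow_two] at this
    linarith

lemma exists_radius_tail_le (n : ℕ) {q Q ε : ℝ} (hq : 2 < q) (hε : 0 < ε) :
    ∃ R : ℝ, 1 ≤ R ∧ ∀ (μ : Measure (En n)) [IsFiniteMeasure μ],
      Integrable (fun v => ‖v‖ ^ q) μ → ∫ v, ‖v‖ ^ q ∂μ ≤ Q →
      ∫ v in (closedBall 0 R)ᶜ, (1 + ‖v‖ ^ 2) ∂μ ≤ ε := by
  have ht : Filter.Tendsto (fun R : ℝ => 2 * R ^ (-(q - 2)) * |Q|) Filter.atTop (nhds 0) := by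
    simpa using ((tendsto_rpow_neg_atTop (sub_pos.2 hq)).const_mul 2).mul_const |Q|
  obtain ⟨R, hR, hR1⟩ :=
    ((ht.eventually (ge_mem_nhds hε)).and (Filter.eventually_ge_atTop 1)).exists
  refine ⟨R, hR1, fun μ _ hi hQ => ?_⟩
  have hR0 : 0 < R := by linarith
  calc ∫ v in (closedBall 0 R)ᶜ, (1 + ‖v‖ ^ 2) ∂μ
      ≤ ∫ v in (closedBall 0 R)ᶜ, 2 * R ^ (-(q - 2)) * ‖v‖ ^ q ∂μ := by
        refine setIntegral_mono_on (integrable_one_add_sq hq hi).integrableOn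
          (hi.const_mul _).integrableOn measurableSet_closedBall.compl fun v hv => ?_
        have hv' : R < ‖v‖ := by simpa using hv
        have hv0 : 0 < ‖v‖ := by linarith
        have h1 : ‖v‖ ^ q = ‖v‖ ^ (q - 2) * ‖v‖ ^ 2 := by
          rw [← Real.rpow_two, ← Real.rpow_add hv0]; ring_nf
        have h2 : R ^ (q - 2) ≤ ‖v‖ ^ (q - 2) :=
          Real.rpow_le_rpow hR0.le hv'.le (by linarith)
        have h3 : 1 ≤ R ^ (-(q - 2)) * ‖v‖ ^ (q - 2) := by
          rw [Real.rpow_neg hR0.le, ← div_eq_inv_mul, one_le_div (by positivity)]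
          exact h2
        rw [h1]
        nlinarith [mul_le_mul_of_nonneg_right h3 (sq_nonneg ‖v‖)]
    _ ≤ ∫ v, 2 * R ^ (-(q - 2)) * ‖v‖ ^ q ∂μ :=
        setIntegral_le_integral (hi.const_mul _) (ae_of_all _ fun v => by positivity)
    _ = 2 * R ^ (-(q - 2)) * ∫ v, ‖v‖ ^ q ∂μ := integral_const_mul _ _
    _ ≤ 2 * R ^ (-(q - 2)) * |Q| := by
        gcongr
        exact hQ.trans (le_abs_self Q)
    _ ≤ ε := hR

lemma Admissible.exists_radius_mass (n : ℕ) {m M p Q q : ℝ} (hq : 2 < q) (hm : 0 < m) :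
    ∃ R : ℝ, 1 ≤ R ∧ ∀ μ : Measure (En n), Admissible m M p Q q μ →
      m / 2 ≤ μ.real (closedBall 0 R) := by
  obtain ⟨R, hR, h⟩ := exists_radius_tail_le n (Q := Q) hq (half_pos hm)
  refine ⟨R, hR, fun μ hμ => ?_⟩
  have := hμ.finite
  have h1 := h μ hμ.integrable_rpow hμ.moment_le
  have h2 : μ.real (closedBall 0 R)ᶜ ≤ ∫ v in (closedBall 0 R)ᶜ, (1 + ‖v‖ ^ 2) ∂μ := by
    calc μ.real (closedBall 0 R)ᶜ = ∫ v in (closedBall (0 : En n) R)ᶜ, (1 : ℝ) ∂μ := by simp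
      _ ≤ _ := by
        refine setIntegral_mono (integrable_const _)
          (integrable_one_add_sq hq hμ.integrable_rpow).integrableOn fun v => ?_
        nlinarith [sq_nonneg ‖v‖]
  have h3 := measureReal_add_measureReal_compl (μ := μ)
    (measurableSet_closedBall (x := (0 : En n)) (ε := R))
  linarith [hμ.mass_ge]

lemma Admissible.exists_radius_variance (n : ℕ) {m M p Q q : ℝ} (hq : 2 < q) (hp : 0 < p)
    (K : ℝ) :
    ∃ R : ℝ, 1 ≤ R ∧ ∀ μ : Measure (En n), Admissible m M p Q q μ →
      ∀ σ : En n, ‖σ‖ = 1 → ∃ η : En n, ‖η‖ = 1 ∧ ⟪σ, η⟫ = 0 ∧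
        ∀ c : ℝ, |c| ≤ K → p / 2 ≤ ∫ v in closedBall 0 R, (⟪v, η⟫ - c) ^ 2 ∂μ := by
  have hK : 0 < 2 * (1 + K ^ 2) := by positivity
  obtain ⟨R, hR, h⟩ := exists_radius_tail_le n (Q := Q) hq (div_pos (half_pos hp) hK)
  refine ⟨R, hR, fun μ hμ σ hσ => ?_⟩
  have := hμ.finite
  obtain ⟨η, hη, hση, hv⟩ := hμ.variance_ge σ hσ
  refine ⟨η, hη, hση, fun c hc => ?_⟩
  have h1 := h μ hμ.integrable_rpow hμ.moment_le
  have hint := integrable_one_add_sq hq hμ.integrable_rpow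
  have hb : ∀ v : En n, (⟪v, η⟫ - c) ^ 2 ≤ 2 * (1 + K ^ 2) * (1 + ‖v‖ ^ 2) := fun v => by
    have h2 : ⟪v, η⟫ ^ 2 ≤ ‖v‖ ^ 2 := by
      have := abs_real_inner_le_norm v η
      rw [hη, mul_one] at this
      exact sq_le_sq' (neg_le_of_abs_le this) (le_of_abs_le this)
    have h3 : c ^ 2 ≤ K ^ 2 := sq_le_sq' (neg_le_of_abs_le hc) (le_of_abs_le hc)
    nlinarith [sq_nonneg (⟪v, η⟫ + c), mul_nonneg (sq_nonneg K) (sq_nonneg ‖v‖)]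
  have hint' : Integrable (fun v => (⟪v, η⟫ - c) ^ 2) μ := by
    refine (hint.const_mul (2 * (1 + K ^ 2))).mono' (by fun_prop) (ae_of_all _ fun v => ?_)
    rw [Real.norm_of_nonneg (by positivity)]
    exact hb v
  have h2 : ∫ v in (closedBall 0 R)ᶜ, (⟪v, η⟫ - c) ^ 2 ∂μ ≤ p / 2 := by
    calc _ ≤ ∫ v in (closedBall 0 R)ᶜ, 2 * (1 + K ^ 2) * (1 + ‖v‖ ^ 2) ∂μ :=
          setIntegral_mono hint'.integrableOn (hint.const_mul _).integrableOn hb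
      _ = 2 * (1 + K ^ 2) * ∫ v in (closedBall 0 R)ᶜ, (1 + ‖v‖ ^ 2) ∂μ :=
          integral_const_mul _ _
      _ ≤ 2 * (1 + K ^ 2) * (p / 2 / (2 * (1 + K ^ 2))) := by gcongr
      _ = p / 2 := by field_simp
  have h3 := integral_add_compl (measurableSet_closedBall (x := (0 : En n)) (ε := R)) hint'
  linarith [hv c]

/-- Lower bound for a nonnegative integral through a continuous minorant on a bounded set. -/
lemma ofReal_setIntegral_le_lintegral {n : ℕ} {μ : Measure (En n)} [IsFiniteMeasure μ]
    {S : Set (En n)} (hS : MeasurableSet S) {R : ℝ} (hSR : S ⊆ closedBall 0 R)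
    {g k : En n → ℝ} (hg : Continuous g) (hg0 : ∀ v, 0 ≤ g v)
    (hgk : ∀ v ∈ S, g v ≤ k v) :
    ENNReal.ofReal (∫ v in S, g v ∂μ) ≤ ∫⁻ v, ENNReal.ofReal (k v) ∂μ := by
  have hi : IntegrableOn g S μ :=
    (hg.continuousOn.integrableOn_compact (isCompact_closedBall 0 R)).mono_set hSR
  rw [ofReal_integral_eq_lintegral_ofReal hi (ae_of_all _ hg0)]
  exact (setLIntegral_mono' hS fun v hv => ENNReal.ofReal_le_ofReal (hgk v hv)).trans
    (setLIntegral_le_lintegral _ _)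

lemma landauQF_eq_lintegral {n : ℕ} (γ : ℝ) {f : En n → ℝ} (hf : Measurable f)
    (hf0 : ∀ v, 0 ≤ f v) (V a : En n) :
    landauQF n γ f V a = ∫⁻ v, ENNReal.ofReal (landauKernel γ a (V - v))
      ∂(volume.withDensity fun v => ENNReal.ofReal (f v)) := by
  have hk : Measurable fun v => ENNReal.ofReal (landauKernel γ a (V - v)) :=
    ((measurable_landauKernel γ a).comp (measurable_const.sub measurable_id)).ennreal_ofReal
  rw [lintegral_withDensity_eq_lintegral_mul _ hf.ennreal_ofReal hk, landauQF,
    ← lintegral_sub_left_eq_self _ V]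
  refine lintegral_congr fun v => ?_
  simp only [Pi.mul_apply, sub_sub_cancel]
  rw [← ENNReal.ofReal_mul (hf0 v), landauKernel, mul_comm]

lemma integral_sq_sub_mean_le {α : Type*} [MeasurableSpace α] {μ : Measure α}
    [IsFiniteMeasure μ] {X : α → ℝ} (hX : Integrable X μ) (hX2 : Integrable (fun x => X x ^ 2) μ)
    {b : ℝ} (hb : ∫ x, X x ∂μ = b * μ.real univ) (c : ℝ) :
    ∫ x, (X x - b) ^ 2 ∂μ ≤ ∫ x, (X x - c) ^ 2 ∂μ := by
  have key : ∀ d : ℝ, ∫ x, (X x - d) ^ 2 ∂μ =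
      ∫ x, X x ^ 2 ∂μ - 2 * d * (b * μ.real univ) + d ^ 2 * μ.real univ := fun d => by
    have hX' : Integrable (fun x => 2 * d * X x) μ := hX.const_mul _
    have hX2' : Integrable (fun x => X x ^ 2 - 2 * d * X x) μ := hX2.sub hX'
    calc ∫ x, (X x - d) ^ 2 ∂μ = ∫ x, (X x ^ 2 - 2 * d * X x + d ^ 2) ∂μ :=
          integral_congr_ae (ae_of_all _ fun x => by ring)
      _ = _ := by
        rw [integral_add hX2' (integrable_const _),
          integral_sub hX2 hX', integral_const_mul, hb, integral_const, smul_eq_mul]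
        ring
  rw [key, key]
  nlinarith [mul_nonneg (sq_nonneg (b - c)) (measureReal_nonneg (μ := μ) (s := univ))]

lemma admissible_withDensity {n : ℕ} {m₀ M₀ p₀ Mq q : ℝ} (hm₀ : 0 < m₀) (hp₀ : 0 < p₀)
    (hq : 2 < q) {f : En n → ℝ} (hf : Measurable f) (hf0 : ∀ v, 0 ≤ f v)
    (hmass : MassBound f m₀ M₀) (hpr : PressureLB f p₀) (hmom : MomentBound f q Mq) :
    Admissible m₀ M₀ (p₀ / 2) (max Mq 0) q
      (volume.withDensity fun v => ENNReal.ofReal (f v)) := by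
  set μ : Measure (En n) := volume.withDensity fun v => ENNReal.ofReal (f v) with hμ
  have hlint : ∀ g : En n → ℝ, Measurable g →
      ∫⁻ v, ENNReal.ofReal (f v * g v) = ∫⁻ v, ENNReal.ofReal (g v) ∂μ := fun g hg => by
    rw [hμ, lintegral_withDensity_eq_lintegral_mul _ hf.ennreal_ofReal hg.ennreal_ofReal]
    exact lintegral_congr fun v => by simp [ENNReal.ofReal_mul (hf0 v)]
  have huniv : μ univ = ∫⁻ v, ENNReal.ofReal (f v) := by
    rw [hμ, withDensity_apply _ MeasurableSet.univ, Measure.restrict_univ]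
  have hle : μ univ ≤ ENNReal.ofReal M₀ := huniv ▸ hmass.2
  have hge : ENNReal.ofReal m₀ ≤ μ univ := huniv ▸ hmass.1
  have hfin : IsFiniteMeasure μ := ⟨hle.trans_lt ENNReal.ofReal_lt_top⟩
  have hM₀ : 0 < M₀ := by
    rw [← ENNReal.ofReal_pos]
    exact (ENNReal.ofReal_pos.2 hm₀).trans_le (hge.trans hle)
  have hm : m₀ ≤ μ.real univ := (ENNReal.ofReal_le_iff_le_toReal (measure_ne_top _ _)).1 hge
  have hmq : ∫⁻ v, ENNReal.ofReal (‖v‖ ^ q) ∂μ ≤ ENNReal.ofReal Mq :=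
    (hlint _ (by fun_prop)).symm.trans_le hmom
  have hq_int : Integrable (fun v : En n => ‖v‖ ^ q) μ := by
    refine ⟨(by fun_prop : Measurable fun v : En n => ‖v‖ ^ q).aestronglyMeasurable, ?_⟩
    rw [hasFiniteIntegral_iff_ofReal (ae_of_all _ fun v => by positivity)]
    exact hmq.trans_lt ENNReal.ofReal_lt_top
  refine ⟨hfin, hm, ENNReal.toReal_le_of_le_ofReal hM₀.le hle, hq_int, ?_, fun σ hσ => ?_⟩
  · rw [integral_eq_lintegral_of_nonneg_ae (ae_of_all _ fun v => by positivity)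
      hq_int.aestronglyMeasurable]
    refine ENNReal.toReal_le_of_le_ofReal (le_max_right _ _) (hmq.trans ?_)
    exact ENNReal.ofReal_le_ofReal (le_max_left _ _)
  · obtain ⟨η, hη, hησ, hpη⟩ := hpr σ hσ (p₀ / 2) (half_pos hp₀)
    refine ⟨η, hη, by rw [real_inner_comm]; exact hησ, fun c => ?_⟩
    have h2 := integrable_one_add_sq hq hq_int
    have hid : Integrable (fun v : En n => v) μ := by
      refine h2.mono' measurable_id.aestronglyMeasurable (ae_of_all _ fun v => ?_)
      nlinarith [sq_nonneg (‖v‖ - 1), sq_nonneg ‖v‖]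
    have hX : Integrable (fun v => ⟪v, η⟫) μ := hid.inner_const η
    have hX2 : Integrable (fun v => ⟪v, η⟫ ^ 2) μ := by
      refine h2.mono' (by fun_prop) (ae_of_all _ fun v => ?_)
      have := abs_real_inner_le_norm v η
      rw [hη, mul_one] at this
      rw [Real.norm_of_nonneg (by positivity)]
      have := sq_le_sq' (neg_le_of_abs_le this) (le_of_abs_le this)
      linarith
    have hmean : ∫ v, ⟪v, η⟫ ∂μ = ⟪vbar f, η⟫ * μ.real univ := by
      have h3 : ∫ v, f v = μ.real univ := by
        rw [integral_eq_lintegral_of_nonneg_ae (ae_of_all _ hf0) hf.aestronglyMeasurable,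
          ← huniv, Measure.real]
      have h4 : ∫ v, f v • v = ∫ v, v ∂μ := by
        rw [hμ, integral_withDensity_eq_integral_toReal_smul hf.ennreal_ofReal
          (ae_of_all _ fun v => ENNReal.ofReal_lt_top)]
        exact integral_congr_ae (ae_of_all _ fun v => by simp [ENNReal.toReal_ofReal (hf0 v)])
      have h5 : ∫ v, ⟪v, η⟫ ∂μ = ⟪∫ v, v ∂μ, η⟫ := by
        rw [real_inner_comm, ← integral_inner hid]
        exact integral_congr_ae (ae_of_all _ fun v => real_inner_comm _ _)
      have : μ.real univ ≠ 0 := by linarith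
      rw [vbar, h3, h4, h5, inner_smul_left, conj_trivial]
      field_simp
    refine le_trans ?_ (integral_sq_sub_mean_le hX hX2 hmean c)
    rw [← lintegral_sub_right_eq_self _ (vbar f)] at hpη
    simp only [add_sub_cancel, inner_sub_left] at hpη
    rw [hlint _ (by fun_prop), sub_half] at hpη
    rw [integral_eq_lintegral_of_nonneg_ae (ae_of_all _ fun v => by positivity) (by fun_prop)]
    refine (ENNReal.ofReal_le_iff_le_toReal ?_).1 hpη
    have h6 : Integrable (fun v => (⟪v, η⟫ - ⟪vbar f, η⟫) ^ 2) μ := by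
      have := (hX2.sub (hX.const_mul (2 * ⟪vbar f, η⟫))).add
        (integrable_const (⟪vbar f, η⟫ ^ 2))
      exact this.congr (ae_of_all _ fun v => by simp only [Pi.add_apply, Pi.sub_apply]; ring)
    rw [← ofReal_integral_eq_lintegral_ofReal h6 (ae_of_all _ fun v => by positivity)]
    exact ENNReal.ofReal_ne_top

/-- Uniform ellipticity of the Landau diffusion matrix at bounded velocities. -/
lemma Admissible.exists_lower_bound_local (n : ℕ) (γ : ℝ) {m M p Q q : ℝ} (hq : 2 < q)
    (hp : 0 < p) (K : ℝ) :
    ∃ lam : ℝ, 0 < lam ∧ ∀ μ : Measure (En n), Admissible m M p Q q μ →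
      ∀ V a : En n, ‖V‖ ≤ K → 1 ≤ ‖a‖ →
        ENNReal.ofReal lam ≤ ∫⁻ v, ENNReal.ofReal (landauKernel γ a (V - v)) ∂μ := by
  obtain ⟨R, hR, hvar⟩ :=
    Admissible.exists_radius_variance (n := n) (m := m) (M := M) (Q := Q) hq hp K
  set r : ℝ := min 1 (p / (4 * (|M| + 1))) with hr
  have hr0 : 0 < r := by positivity
  have hr1 : r ≤ 1 := min_le_left _ _
  have hrM : r ^ 2 * M ≤ p / 4 := by
    have h1 : r * (4 * (|M| + 1)) ≤ p := (le_div_iff₀ (by positivity)).1 (min_le_right _ _)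
    nlinarith [le_abs_self M, abs_nonneg M, mul_le_mul_of_nonneg_left (le_abs_self M) hr0.le,
      mul_le_mul_of_nonneg_left hr1 (mul_nonneg hr0.le (abs_nonneg M)), sq_nonneg r,
      mul_le_mul_of_nonneg_left (le_abs_self M) (sq_nonneg r)]
  set c : ℝ := min (r ^ γ) ((R + |K|) ^ γ) with hc
  have hc0 : 0 < c := by positivity
  refine ⟨c * (p / 4), by positivity, fun μ hμ V a hV ha => ?_⟩
  have := hμ.finite
  have ha0 : 0 < ‖a‖ := by linarith
  set ξ : En n := ‖a‖⁻¹ • a with hξ_def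
  have hξ : ‖ξ‖ = 1 := by
    rw [hξ_def, norm_smul, norm_inv, norm_norm, inv_mul_cancel₀ ha0.ne']
  obtain ⟨η, hη, hξη, hv⟩ := hvar μ hμ ξ hξ
  have hVη : |⟪V, η⟫| ≤ K := by
    have := abs_real_inner_le_norm V η
    rw [hη, mul_one] at this
    exact this.trans hV
  have haξ : ⟪a, ξ⟫ = ‖a‖ := by
    rw [hξ_def, inner_smul_right, real_inner_self_eq_norm_sq]; field_simp
  have haη : ⟪a, η⟫ = 0 := by
    rw [hξ_def, inner_smul_left, conj_trivial] at hξη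
    exact (mul_eq_zero.1 hξη).resolve_left (by positivity)
  have hball : MeasurableSet (ball V r) := measurableSet_ball
  refine le_trans (ENNReal.ofReal_le_ofReal ?_) (ofReal_setIntegral_le_lintegral
    (S := closedBall 0 R \ ball V r) (measurableSet_closedBall.diff hball) sdiff_subset
    (g := fun v => c * (⟪v, η⟫ - ⟪V, η⟫) ^ 2) (by fun_prop) (fun v => by positivity) ?_)
  · rw [integral_const_mul]
    gcongr
    have hi : IntegrableOn (fun v : En n => (⟪v, η⟫ - ⟪V, η⟫) ^ 2) (closedBall 0 R) μ :=
      (by fun_prop : Continuous fun v : En n =>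
        (⟪v, η⟫ - ⟪V, η⟫) ^ 2).continuousOn.integrableOn_compact (isCompact_closedBall 0 R)
    have h1 := integral_inter_add_sdiff hball hi
    have h2 : ∫ v in closedBall 0 R ∩ ball V r, (⟪v, η⟫ - ⟪V, η⟫) ^ 2 ∂μ ≤ p / 4 := by
      calc _ ≤ ∫ v in closedBall 0 R ∩ ball V r, r ^ 2 ∂μ := by
            refine setIntegral_mono_on (hi.mono_set inter_subset_left) (integrable_const _)
              (measurableSet_closedBall.inter hball) fun v hv => ?_
            have h3 : ‖v - V‖ < r := by simpa [dist_eq_norm] using hv.2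
            have h4 := abs_real_inner_le_norm (v - V) η
            rw [hη, mul_one] at h4
            rw [← inner_sub_left]
            exact sq_le_sq' (by linarith [neg_le_of_abs_le h4]) (by linarith [le_of_abs_le h4])
        _ = μ.real (closedBall 0 R ∩ ball V r) * r ^ 2 := by simp
        _ ≤ M * r ^ 2 := by
            gcongr
            exact (measureReal_mono (subset_univ _)).trans hμ.mass_le
        _ ≤ p / 4 := by linarith
    linarith [hv _ hVη]
  · rintro v ⟨hv1, hv2⟩
    have hv1' : ‖v‖ ≤ R := by simpa using hv1
    have hlow : r ≤ ‖V - v‖ := by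
      rw [mem_ball, not_lt, dist_comm, dist_eq_norm] at hv2; exact hv2
    have hup : ‖V - v‖ ≤ R + |K| := by
      linarith [norm_sub_le V v, le_abs_self K]
    have hw : V - v ≠ 0 := norm_pos_iff.1 (hr0.trans_le hlow)
    refine le_trans ?_ (mul_sq_area_le_landauKernel γ (V - v) a ξ η hξ hη hξη hw)
    rw [haη, haξ, mul_zero, zero_sub, inner_sub_left]
    refine mul_le_mul (min_rpow_le_rpow γ hr0 hlow hup) ?_ (sq_nonneg _) (by positivity)
    have : 1 ≤ ‖a‖ ^ 2 := one_le_pow₀ ha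
    nlinarith [mul_le_mul_of_nonneg_left this (sq_nonneg (⟪v, η⟫ - ⟪V, η⟫))]

lemma tau0_smul {n : ℕ} {N : ℝ} (hN : 2 ≤ N) {ξ : En n} (hξ : ‖ξ‖ = 1) (u : En n) :
    tau0 (N • ξ) u = u + ((1 / N - 1) * ⟪u, ξ⟫) • ξ := by
  have hn : ‖N • ξ‖ = N := by rw [norm_smul, hξ, mul_one, Real.norm_of_nonneg (by linarith)]
  have hN0 : N ≠ 0 := by linarith
  rw [tau0, hn, if_pos hN, inner_smul_right, smul_smul]
  congr 2
  field_simp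

lemma tau0inv_smul {n : ℕ} {N : ℝ} (hN : 2 ≤ N) {ξ : En n} (hξ : ‖ξ‖ = 1) (u : En n) :
    tau0inv (N • ξ) u = u + ((N - 1) * ⟪u, ξ⟫) • ξ := by
  have hn : ‖N • ξ‖ = N := by rw [norm_smul, hξ, mul_one, Real.norm_of_nonneg (by linarith)]
  have hN0 : N ≠ 0 := by linarith
  rw [tau0inv, hn, if_pos hN, inner_smul_right, smul_smul]
  congr 2
  field_simp

lemma norm_tau0_le {n : ℕ} {N : ℝ} (hN : 2 ≤ N) {ξ : En n} (hξ : ‖ξ‖ = 1) (u : En n) :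
    ‖tau0 (N • ξ) u‖ ≤ 2 * ‖u‖ := by
  have h1 := abs_real_inner_le_norm u ξ
  rw [hξ, mul_one] at h1
  have h2 : |1 / N - 1| ≤ 1 := by
    have h3 : 1 / N ≤ 1 := (div_le_one (by linarith)).2 (by linarith)
    have h4 : 0 ≤ 1 / N := by positivity
    rw [abs_le]; constructor <;> linarith
  rw [tau0_smul hN hξ]
  calc _ ≤ ‖u‖ + ‖((1 / N - 1) * ⟪u, ξ⟫) • ξ‖ := norm_add_le _ _
    _ = ‖u‖ + |1 / N - 1| * |⟪u, ξ⟫| := by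
        rw [norm_smul, hξ, mul_one, Real.norm_eq_abs, abs_mul]
    _ ≤ ‖u‖ + 1 * ‖u‖ := by gcongr
    _ = 2 * ‖u‖ := by ring

lemma norm_le_norm_tau0inv {n : ℕ} {N : ℝ} (hN : 2 ≤ N) {ξ : En n} (hξ : ‖ξ‖ = 1) (u : En n) :
    ‖u‖ ≤ ‖tau0inv (N • ξ) u‖ := by
  refine le_of_sq_le_sq ?_ (norm_nonneg _)
  rw [tau0inv_smul hN hξ, norm_add_sq_real, inner_smul_right, norm_smul, hξ, mul_one,
    Real.norm_eq_abs, sq_abs]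
  nlinarith [mul_nonneg (by nlinarith : 0 ≤ N ^ 2 - 1) (sq_nonneg ⟪u, ξ⟫)]

/-- Far from the origin, the rescaled kernel controls the square of an explicit affine function. -/
lemma sq_le_rpow_mul_landauKernel {n : ℕ} (γ : ℝ) {N R : ℝ} (hR : 0 ≤ R)
    (hN : 2 * (R + 4) ≤ N) {ξ η v u : En n} (e : En n) (hξ : ‖ξ‖ = 1) (hη : ‖η‖ = 1)
    (hξη : ⟪ξ, η⟫ = 0) (hv : ‖v‖ ≤ 2) (hu : ‖u‖ ≤ R) :
    min ((1 / 2 : ℝ) ^ γ) (2 ^ γ) *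
        ((1 + (⟪v, ξ⟫ / N - ⟪u, ξ⟫) / N) * ⟪e, η⟫ - ⟪v - u, η⟫ * ⟪e, ξ⟫) ^ 2 ≤
      N ^ (-γ - 2) * landauKernel γ (tau0inv (N • ξ) e) (N • ξ + tau0 (N • ξ) v - u) := by
  have hN2 : 2 ≤ N := by linarith
  have hN0 : 0 < N := by linarith
  have hξξ : ⟪ξ, ξ⟫ = 1 := by rw [real_inner_self_eq_norm_sq, hξ]; norm_num
  set w : En n := N • ξ + tau0 (N • ξ) v - u with hw
  set a : En n := tau0inv (N • ξ) e with ha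
  have hNξ : ‖N • ξ‖ = N := by rw [norm_smul, hξ, mul_one, Real.norm_of_nonneg hN0.le]
  have ht := norm_tau0_le hN2 hξ v
  have hsmall : ‖tau0 (N • ξ) v - u‖ ≤ N / 2 :=
    (norm_sub_le _ _).trans (by linarith)
  have hw' : w = N • ξ + (tau0 (N • ξ) v - u) := by rw [hw]; abel
  have hlow : N / 2 ≤ ‖w‖ := by
    have := norm_sub_le w (tau0 (N • ξ) v - u)
    rw [hw', add_sub_cancel_right, ← hw', hNξ] at this
    linarith
  have hup : ‖w‖ ≤ 2 * N := by
    rw [hw']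
    refine (norm_add_le _ _).trans ?_
    linarith
  have hw0 : w ≠ 0 := norm_pos_iff.1 (by linarith)
  have hwξ : ⟪w, ξ⟫ = N * (1 + (⟪v, ξ⟫ / N - ⟪u, ξ⟫) / N) := by
    rw [hw, tau0_smul hN2 hξ]
    simp only [inner_sub_left, inner_add_left, inner_smul_left, conj_trivial, hξξ]
    field_simp
    ring
  have hwη : ⟪w, η⟫ = ⟪v - u, η⟫ := by
    rw [hw, tau0_smul hN2 hξ]
    simp only [inner_sub_left, inner_add_left, inner_smul_left, conj_trivial, hξη]
    ring
  have haξ : ⟪a, ξ⟫ = N * ⟪e, ξ⟫ := by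
    rw [ha, tau0inv_smul hN2 hξ]
    simp only [inner_add_left, inner_smul_left, conj_trivial, hξξ]
    ring
  have haη : ⟪a, η⟫ = ⟪e, η⟫ := by
    rw [ha, tau0inv_smul hN2 hξ]
    simp only [inner_add_left, inner_smul_left, conj_trivial, hξη]
    ring
  have hk := mul_sq_area_le_landauKernel γ w a ξ η hξ hη hξη hw0
  have hmin : min ((1 / 2 : ℝ) ^ γ) (2 ^ γ) ≤ (‖w‖ / N) ^ γ :=
    min_rpow_le_rpow γ (by norm_num) (by rw [le_div_iff₀ hN0]; linarith)
      (by rw [div_le_iff₀ hN0]; exact hup)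
  set D : ℝ := (1 + (⟪v, ξ⟫ / N - ⟪u, ξ⟫) / N) * ⟪e, η⟫ - ⟪v - u, η⟫ * ⟪e, ξ⟫ with hD
  have hDw : ⟪w, ξ⟫ * ⟪a, η⟫ - ⟪w, η⟫ * ⟪a, ξ⟫ = N * D := by
    rw [hwξ, hwη, haξ, haη, hD]; ring
  rw [hDw] at hk
  calc _ ≤ (‖w‖ / N) ^ γ * D ^ 2 := by gcongr
    _ = N ^ (-γ - 2) * (‖w‖ ^ γ * (N * D) ^ 2) := by
        rw [Real.div_rpow (norm_nonneg _) hN0.le, Real.rpow_sub hN0, Real.rpow_neg hN0.le,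
          Real.rpow_two]
        field_simp
    _ ≤ _ := by gcongr

set_option maxHeartbeats 1000000 in
/-- Uniform ellipticity of the transformed Landau diffusion matrix for large `v₀`. -/
lemma Admissible.exists_lower_bound_far (n : ℕ) (γ : ℝ) {m M p Q q : ℝ} (hq : 2 < q)
    (hm : 0 < m) (hp : 0 < p) :
    ∃ N₀ lam : ℝ, 2 ≤ N₀ ∧ 0 < lam ∧ ∀ μ : Measure (En n), Admissible m M p Q q μ →
      ∀ (N : ℝ) (ξ v e : En n), N₀ ≤ N → ‖ξ‖ = 1 → ‖v‖ ≤ 2 → ‖e‖ = 1 →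
        ENNReal.ofReal lam ≤ ∫⁻ u, ENNReal.ofReal (N ^ (-γ - 2) *
          landauKernel γ (tau0inv (N • ξ) e) (N • ξ + tau0 (N • ξ) v - u)) ∂μ := by
  obtain ⟨R₀, hR₀, hmass⟩ :=
    Admissible.exists_radius_mass (n := n) (M := M) (p := p) (Q := Q) hq hm
  set δ : ℝ := 1 / (8 * (2 + R₀)) with hδ
  have hδ0 : 0 < δ := by positivity
  have hδR : δ * (2 + R₀) = 1 / 8 := by rw [hδ]; field_simp
  have hδ1 : δ ≤ 1 / 2 := by nlinarith
  obtain ⟨R, hR, hvar⟩ := Admissible.exists_radius_variance (n := n) (m := m) (M := M)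
    (Q := Q) hq hp (2 + 1 / δ)
  set c : ℝ := min ((1 / 2 : ℝ) ^ γ) (2 ^ γ) with hc
  have hc0 : 0 < c := by positivity
  set B : ℝ := 8 * (2 + R) * (|M| + 1) / (δ ^ 2 * p) with hB
  have hB0 : 0 < B := by positivity
  refine ⟨2 * (R₀ + 4) + 2 * (R + 4) + B, min (c * (δ ^ 2 * p / 8)) (c / 16 * (m / 2)),
    by linarith, by positivity, fun μ hμ N ξ v e hN hξ hv he => ?_⟩
  have := hμ.finite
  have hN0 : 0 < N := by linarith
  have hvw : ∀ x y : En n, ‖y‖ = 1 → |⟪x, y⟫| ≤ ‖x‖ := fun x y hy => by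
    have := abs_real_inner_le_norm x y
    rwa [hy, mul_one] at this
  have hdelta : ∀ (S : ℝ) (u : En n), ‖u‖ ≤ S →
      |(⟪v, ξ⟫ / N - ⟪u, ξ⟫) / N| ≤ (2 + S) / N := fun S u hu => by
    rw [abs_div, abs_of_pos hN0]
    gcongr
    have h1 : |⟪v, ξ⟫ / N| ≤ 2 := by
      rw [abs_div, abs_of_pos hN0, div_le_iff₀ hN0]
      linarith [hvw v ξ hξ]
    linarith [abs_sub (⟪v, ξ⟫ / N) ⟪u, ξ⟫, hvw u ξ hξ]
  by_cases hcase : δ ≤ |⟪e, ξ⟫|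
  · refine (ENNReal.ofReal_le_ofReal (min_le_left _ _)).trans ?_
    obtain ⟨η, hη, hξη, hvη⟩ := hvar μ hμ ξ hξ
    set α : ℝ := ⟪e, ξ⟫ with hα
    set β : ℝ := ⟪e, η⟫ with hβ
    have hα0 : α ≠ 0 := abs_pos.1 (hδ0.trans_le hcase)
    have hβ1 : |β| ≤ 1 := (hvw e η hη).trans he.le
    set b : ℝ := ⟪v, η⟫ - β / α with hb
    have hbK : |b| ≤ 2 + 1 / δ := by
      have h1 : |β / α| ≤ 1 / δ := by
        rw [abs_div]; gcongr
      linarith [abs_sub ⟪v, η⟫ (β / α), hvw v η hη]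
    have hd : (2 + R) / N * |M| ≤ δ ^ 2 * p / 8 := by
      have h1 : B ≤ N := by linarith
      rw [hB, div_le_iff₀ (by positivity)] at h1
      rw [div_mul_eq_mul_div, div_le_iff₀ hN0]
      nlinarith [abs_nonneg M]
    have hd1 : (2 + R) / N ≤ 1 := by rw [div_le_one hN0]; linarith
    have hd0 : 0 ≤ (2 + R) / N := by positivity
    refine le_trans (ENNReal.ofReal_le_ofReal ?_) (ofReal_setIntegral_le_lintegral
      (S := closedBall 0 R) measurableSet_closedBall subset_rfl
      (g := fun u => c * ((1 + (⟪v, ξ⟫ / N - ⟪u, ξ⟫) / N) * β - ⟪v - u, η⟫ * α) ^ 2)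
      (by fun_prop) (fun u => by positivity) fun u hu =>
        sq_le_rpow_mul_landauKernel (R := R) γ (by linarith) (by linarith) e hξ hη hξη hv
          (by simpa using hu))
    have hi : IntegrableOn (fun u : En n => (⟪u, η⟫ - b) ^ 2) (closedBall 0 R) μ :=
      (by fun_prop : Continuous fun u : En n =>
        (⟪u, η⟫ - b) ^ 2).continuousOn.integrableOn_compact (isCompact_closedBall 0 R)
    have hi2 : IntegrableOn (fun u : En n => ((1 + (⟪v, ξ⟫ / N - ⟪u, ξ⟫) / N) * β
        - ⟪v - u, η⟫ * α) ^ 2) (closedBall 0 R) μ :=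
      (by fun_prop : Continuous fun u : En n => ((1 + (⟪v, ξ⟫ / N - ⟪u, ξ⟫) / N) * β
        - ⟪v - u, η⟫ * α) ^ 2).continuousOn.integrableOn_compact (isCompact_closedBall 0 R)
    rw [integral_const_mul]
    gcongr
    have hpt : ∀ u ∈ closedBall (0 : En n) R, δ ^ 2 / 2 * (⟪u, η⟫ - b) ^ 2 - (2 + R) / N ≤
        ((1 + (⟪v, ξ⟫ / N - ⟪u, ξ⟫) / N) * β - ⟪v - u, η⟫ * α) ^ 2 := fun u hu => by
      have hd2 := hdelta R u (by simpa using hu)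
      set d : ℝ := (⟪v, ξ⟫ / N - ⟪u, ξ⟫) / N with hd_def
      have h1 : (1 + d) * β - ⟪v - u, η⟫ * α = α * (⟪u, η⟫ - b) + d * β := by
        rw [hb, inner_sub_left]; field_simp; ring
      have h2 : δ ^ 2 ≤ α ^ 2 := by
        rw [← sq_abs α]; gcongr
      have h3 : (d * β) ^ 2 ≤ (2 + R) / N := by
        have h4 : |d * β| ≤ (2 + R) / N := by
          rw [abs_mul]
          calc _ ≤ (2 + R) / N * 1 := by gcongr
            _ = _ := mul_one _
        rw [← sq_abs]
        nlinarith [abs_nonneg (d * β)]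
      rw [h1]
      nlinarith [sq_nonneg (α * (⟪u, η⟫ - b) + 2 * (d * β)),
        mul_le_mul_of_nonneg_right h2 (sq_nonneg (⟪u, η⟫ - b))]
    have hmono := setIntegral_mono_on (μ := μ) ((hi.const_mul (δ ^ 2 / 2)).sub
      (integrable_const ((2 + R) / N))) hi2 measurableSet_closedBall hpt
    have hsub := integral_sub (hi.const_mul (δ ^ 2 / 2)) (integrable_const
      (μ := μ.restrict (closedBall 0 R)) ((2 + R) / N))
    have hconst : ∫ _ in closedBall (0 : En n) R, (2 + R) / N ∂μ ≤ (2 + R) / N * |M| := by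
      rw [integral_const, smul_eq_mul, mul_comm, measureReal_restrict_apply_univ]
      gcongr
      exact ((measureReal_mono (subset_univ _)).trans hμ.mass_le).trans (le_abs_self M)
    rw [integral_const_mul] at hsub
    have hfin := mul_le_mul_of_nonneg_left (hvη b hbK) (by positivity : 0 ≤ δ ^ 2 / 2)
    have hmono' := hsub.symm.le.trans hmono
    linarith
  · refine (ENNReal.ofReal_le_ofReal (min_le_right _ _)).trans ?_
    rw [not_le] at hcase
    set α : ℝ := ⟪e, ξ⟫ with hα
    have hξξ : ⟪ξ, ξ⟫ = 1 := by rw [real_inner_self_eq_norm_sq, hξ]; norm_num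
    have hα2 : α ^ 2 ≤ 1 / 4 := by
      rw [← sq_abs]; nlinarith [abs_nonneg α]
    set y : En n := e - α • ξ with hy
    have hyn : ‖y‖ ^ 2 = 1 - α ^ 2 := by
      rw [hy, norm_sub_sq_real, inner_smul_right, norm_smul, hξ, he, ← hα, mul_one,
        Real.norm_eq_abs, sq_abs]
      ring
    have hy34 : 3 / 4 ≤ ‖y‖ := by nlinarith [norm_nonneg y]
    have hy0 : 0 < ‖y‖ := by linarith
    have hξy : ⟪ξ, y⟫ = 0 := by
      rw [hy, inner_sub_right, inner_smul_right, hξξ, real_inner_comm, ← hα]; ring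
    have hey : ⟪e, y⟫ = ‖y‖ ^ 2 := by
      rw [hyn, hy, inner_sub_right, inner_smul_right, real_inner_self_eq_norm_sq, he, ← hα]
      ring
    set η : En n := ‖y‖⁻¹ • y with hη_def
    have hη : ‖η‖ = 1 := by
      rw [hη_def, norm_smul, norm_inv, norm_norm, inv_mul_cancel₀ hy0.ne']
    have hξη : ⟪ξ, η⟫ = 0 := by rw [hη_def, inner_smul_right, hξy, mul_zero]
    have heη : ⟪e, η⟫ = ‖y‖ := by
      rw [hη_def, inner_smul_right, hey]; field_simp
    refine le_trans (ENNReal.ofReal_le_ofReal ?_) (ofReal_setIntegral_le_lintegral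
      (S := closedBall 0 R₀) measurableSet_closedBall subset_rfl
      (g := fun _ => c / 16) (by fun_prop) (fun u => by positivity) fun u hu =>
        le_trans ?_ (sq_le_rpow_mul_landauKernel (R := R₀) γ (by linarith) (by linarith) e hξ hη hξη hv
          (by simpa using hu)))
    · rw [setIntegral_const, smul_eq_mul, mul_comm]
      gcongr
      exact hmass μ hμ
    · have hu' : ‖u‖ ≤ R₀ := by simpa using hu
      have hd2 := hdelta R₀ u hu'
      set d : ℝ := (⟪v, ξ⟫ / N - ⟪u, ξ⟫) / N with hd_def
      have hd1 : (2 + R₀) / N ≤ 1 / 2 := by rw [div_le_iff₀ hN0]; linarith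
      have h1 : |⟪v - u, η⟫ * α| ≤ 1 / 8 := by
        rw [abs_mul, ← hδR, mul_comm]
        have h2 : |⟪v - u, η⟫| ≤ 2 + R₀ :=
          (hvw _ η hη).trans ((norm_sub_le v u).trans (by linarith))
        gcongr
      have h3 : 1 / 2 ≤ 1 + d := by linarith [neg_le_of_abs_le hd2]
      have h4 : 1 / 4 ≤ (1 + d) * ‖y‖ - ⟪v - u, η⟫ * α := by
        nlinarith [le_of_abs_le h1]
      rw [heη, ← hα]
      calc c / 16 = c * (1 / 4) ^ 2 := by ring
        _ ≤ _ := by gcongr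

/-- Lemma 7.1 of the paper: uniform ellipticity of the transformed Landau
diffusion matrix. Under mass, pressure, and `q`-moment bounds (`q > 2`), for every `v₀ ∈ ℝⁿ`,
`v ∈ B₂` and unit `e`, `e·Ã(v)e ≥ λ`, with `λ` depending only on `n, m₀, M₀, p₀, M_q, q, γ`
(independent of `v₀`). -/
theorem stmt18 (n : ℕ) (hn : 2 ≤ n) (γ m₀ M₀ p₀ Mq q : ℝ)
    (hγ : -(n : ℝ) < γ) (hm₀ : 0 < m₀) (hp₀ : 0 < p₀) (hq : 2 < q) :
    ∃ lam : ℝ, 0 < lam ∧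
      ∀ f : En n → ℝ, Measurable f → (∀ v, 0 ≤ f v) →
        MassBound f m₀ M₀ → PressureLB f p₀ → MomentBound f q Mq →
        ∀ (v₀ v e : En n), ‖v‖ < 2 → ‖e‖ = 1 →
          ENNReal.ofReal lam ≤ landauQFtilde n γ f v₀ v e := by
  obtain ⟨N₀, lam₁, hN₀, hlam₁, hfar⟩ := Admissible.exists_lower_bound_far n γ (m := m₀)
    (M := M₀) (Q := max Mq 0) hq hm₀ (half_pos hp₀)
  obtain ⟨lam₂, hlam₂, hloc⟩ := Admissible.exists_lower_bound_local n γ (m := m₀)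
    (M := M₀) (Q := max Mq 0) hq (half_pos hp₀) (N₀ + 4)
  set c : ℝ := min ((2 : ℝ) ^ (-γ - 2)) (N₀ ^ (-γ - 2)) with hc
  have hc0 : 0 < c := by positivity
  refine ⟨min lam₁ (min lam₂ (c * lam₂)), by positivity,
    fun f hf hf0 hmass hpr hmom v₀ v e hv he => ?_⟩
  have hadm := admissible_withDensity hm₀ hp₀ hq hf hf0 hmass hpr hmom
  rw [landauQFtilde]
  split_ifs with h2
  · set N : ℝ := ‖v₀‖ with hN
    have hN0 : 0 < N := by linarith
    obtain ⟨ξ, hξ, hv₀⟩ : ∃ ξ : En n, ‖ξ‖ = 1 ∧ v₀ = N • ξ := by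
      refine ⟨N⁻¹ • v₀, ?_, by rw [smul_smul, mul_inv_cancel₀ hN0.ne', one_smul]⟩
      rw [norm_smul, norm_inv, hN, norm_norm, inv_mul_cancel₀ (hN ▸ hN0.ne')]
    clear_value N
    subst hv₀
    rw [landauQF_eq_lintegral γ hf hf0]
    rcases le_total N₀ N with h | h
    · refine (ENNReal.ofReal_le_ofReal (min_le_left _ _)).trans
        ((hfar _ hadm N ξ v e h hξ hv.le he).trans_eq ?_)
      rw [← lintegral_const_mul' _ _ ENNReal.ofReal_ne_top]
      exact lintegral_congr fun u => ENNReal.ofReal_mul (by positivity)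
    · refine (ENNReal.ofReal_le_ofReal ((min_le_right _ _).trans (min_le_right _ _))).trans ?_
      rw [ENNReal.ofReal_mul hc0.le]
      refine mul_le_mul' (ENNReal.ofReal_le_ofReal (min_rpow_le_rpow _ two_pos h2 h))
        (hloc _ hadm _ _ ?_ (he ▸ norm_le_norm_tau0inv h2 hξ e))
      refine (norm_add_le _ _).trans ?_
      linarith [norm_tau0_le h2 hξ v]
  · refine (ENNReal.ofReal_le_ofReal ((min_le_right _ _).trans (min_le_left _ _))).trans ?_
    rw [landauQF_eq_lintegral γ hf hf0]
    refine hloc _ hadm _ _ ((norm_add_le _ _).trans ?_) he.ge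
    rw [not_le] at h2
    linarith
end
end
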